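/- Let 1 < α < 2, β₁ > 1/(α−1) and 1 < β₂ < 1/(α−1), and let (m_n) be a sequence of positive integers such that m_n^{−β₂}/n^{−β₁} → c for some c ∈ (0,∞) as n → ∞. Then lim_{n→∞} ρ(n,−m_n)/(n^{−β₁} m_n^{−β₂(α−1)}) = c · Σ_{i=0}^∞ Σ_{j=0}^∞ V(w_{(∞,j)} c^{−1} (1+j)^{−β₂}, w_{(i,∞)} (1+i)^{−β₁}). -/

import Mathlib

open Filter MeasureTheory Real Set

/-- The kernel `V(x,y) = xy/(x^2+y^2)^{(2-α)/2}` with `V(0,0)=0`. -/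
noncomputable def V (α : ℝ) : ℝ → ℝ → ℝ := fun x y =>
  if x = 0 ∧ y = 0 then 0 else x * y / (x ^ 2 + y ^ 2) ^ ((2 - α) / 2)

lemma V_eq (α x y : ℝ) : V α x y = x * y / (x ^ 2 + y ^ 2) ^ ((2 - α) / 2) := by
  unfold V
  split_ifs with h
  · simp [h.1]
  · rfl

lemma V_hom (α t x y : ℝ) (ht : 0 < t) : V α (t * x) (t * y) = t ^ α * V α x y := by
  rw [V_eq, V_eq]
  have h1 : (t * x) ^ 2 + (t * y) ^ 2 = t ^ 2 * (x ^ 2 + y ^ 2) := by ring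
  rw [h1, Real.mul_rpow (by positivity) (by positivity), ← Real.rpow_natCast t 2,
    ← Real.rpow_mul ht.le]
  have h2 : ((2 : ℕ) : ℝ) * ((2 - α) / 2) = 2 - α := by push_cast; ring
  rw [h2]
  have h3 : t * t = t ^ α * t ^ (2 - α) := by
    rw [← Real.rpow_add ht]
    have : α + (2 - α) = ((2 : ℕ) : ℝ) := by push_cast; ring
    rw [this, Real.rpow_natCast]; ring
  have h4 : t ^ (2 - α) ≠ 0 := (Real.rpow_pos_of_pos ht _).ne'
  have : t * x * (t * y) = t ^ (2 - α) * (t ^ α * (x * y)) := by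
    calc t * x * (t * y) = (t * t) * (x * y) := by ring
      _ = _ := by rw [h3]; ring
  rw [this, mul_div_mul_left _ _ h4, mul_div_assoc]

lemma V_bound (α x y a b : ℝ) (hα : 1 < α) (hα2 : α < 2) (hx : |x| ≤ a) (hy : |y| ≤ b) :
    |V α x y| ≤ a * b ^ (α - 1) := by
  have ha : 0 ≤ a := (abs_nonneg x).trans hx
  have key : |V α x y| ≤ |x| * |y| ^ (α - 1) := by
    by_cases hy0 : y = 0
    · subst hy0
      rw [V_eq]; simp; positivity
    have hyp : 0 < |y| := abs_pos.mpr hy0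
    have hle : |y| ^ (2 - α) ≤ (x ^ 2 + y ^ 2) ^ ((2 - α) / 2) := by
      have : |y| ^ (2 - α) = (y ^ 2) ^ ((2 - α) / 2) := by
        rw [← sq_abs y, ← Real.rpow_natCast |y| 2, ← Real.rpow_mul hyp.le]
        congr 1; push_cast; ring
      rw [this]
      exact Real.rpow_le_rpow (by positivity) (by nlinarith [sq_nonneg x]) (by linarith)
    have hp : 0 < |y| ^ (2 - α) := Real.rpow_pos_of_pos hyp _
    rw [V_eq, abs_div, abs_mul, abs_of_nonneg (by positivity : 0 ≤ (x ^ 2 + y ^ 2) ^ ((2 - α) / 2)),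
      div_le_iff₀ (hp.trans_le hle)]
    have h3 : |y| = |y| ^ (α - 1) * |y| ^ (2 - α) := by
      rw [← Real.rpow_add hyp]
      have : α - 1 + (2 - α) = 1 := by ring
      rw [this, Real.rpow_one]
    calc |x| * |y| = |x| * |y| ^ (α - 1) * |y| ^ (2 - α) := by rw [mul_assoc, ← h3]
      _ ≤ _ := mul_le_mul_of_nonneg_left hle (by positivity)
  exact key.trans (mul_le_mul hx (Real.rpow_le_rpow (abs_nonneg _) hy (by linarith))
    (by positivity) ha)

lemma V_tendsto (α : ℝ) (f g : ℕ → ℝ) (x y : ℝ) (hy : 0 < y)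
    (hf : Tendsto f atTop (nhds x)) (hg : Tendsto g atTop (nhds y)) :
    Tendsto (fun n => V α (f n) (g n)) atTop (nhds (V α x y)) := by
  simp only [V_eq]
  have h : 0 < x ^ 2 + y ^ 2 := by positivity
  exact (hf.mul hg).div (((hf.pow 2).add (hg.pow 2)).rpow_const (Or.inl h.ne'))
    (Real.rpow_pos_of_pos h _).ne'

lemma bdd_seq (u : ℕ → ℝ) (l : ℝ) (h : Tendsto u atTop (nhds l)) : ∃ K, ∀ n, |u n| ≤ K := by
  obtain ⟨K, hK⟩ := h.abs.bddAbove_range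
  exact ⟨K, fun n => hK ⟨n, rfl⟩⟩

lemma w_bdd (w : ℕ → ℕ → ℝ)
    (hA1 : Tendsto (fun p : ℕ × ℕ => w p.1 p.2) (atTop ×ˢ atTop) (nhds 1))
    (winf wco : ℕ → ℝ)
    (hA2 : ∀ i, Tendsto (fun j => w i j) atTop (nhds (winf i)))
    (hA3 : ∀ j, Tendsto (fun i => w i j) atTop (nhds (wco j))) :
    ∃ K, 0 < K ∧ ∀ i j, |w i j| ≤ K := by
  have h1 := hA1.abs.eventually (gt_mem_nhds (show |(1:ℝ)| < 2 by norm_num))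
  rw [prod_atTop_atTop_eq, eventually_atTop] at h1
  obtain ⟨⟨N, M⟩, hNM⟩ := h1
  choose R hR using fun i => bdd_seq _ _ (hA2 i)
  choose S hS using fun j => bdd_seq _ _ (hA3 j)
  have hR0 : ∀ i, 0 ≤ R i := fun i => (abs_nonneg _).trans (hR i 0)
  have hS0 : ∀ i, 0 ≤ S i := fun i => (abs_nonneg _).trans (hS i 0)
  have sR := Finset.sum_nonneg (fun i (_ : i ∈ Finset.range N) => hR0 i)
  have sS := Finset.sum_nonneg (fun i (_ : i ∈ Finset.range M) => hS0 i)
  refine ⟨2 + ∑ i ∈ Finset.range N, R i + ∑ j ∈ Finset.range M, S j, by linarith, fun i j => ?_⟩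
  by_cases hi : i < N
  · have := Finset.single_le_sum (fun i _ => hR0 i) (Finset.mem_range.mpr hi)
    linarith [hR i j]
  by_cases hj : j < M
  · have := Finset.single_le_sum (fun i _ => hS0 i) (Finset.mem_range.mpr hj)
    linarith [hS j i]
  have := hNM (i, j) ⟨not_lt.mp hi, not_lt.mp hj⟩
  simp only at this
  linarith

lemma summ_pow (b : ℝ) (hb : 1 < b) : Summable (fun i : ℕ => (1 + (i : ℝ)) ^ (-b)) := by
  have := (summable_nat_add_iff 1).mpr (Real.summable_nat_rpow.mpr (show -b < -1 by linarith))
  refine this.congr fun i => ?_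
  push_cast; rw [add_comm]

lemma ratio_tendsto (b : ℝ) (i : ℕ) (m : ℕ → ℕ) (hm : Tendsto m atTop atTop) :
    Tendsto (fun n => (1 + ((i + m n : ℕ) : ℝ)) ^ (-b) / (m n : ℝ) ^ (-b)) atTop (nhds 1) := by
  have hm' : Tendsto (fun n => (m n : ℝ)) atTop atTop := tendsto_natCast_atTop_atTop.comp hm
  have h1 : Tendsto (fun n => (1 + (i:ℝ)) / (m n : ℝ) + 1) atTop (nhds (0 + 1)) :=
    (hm'.const_div_atTop _).add_const 1
  rw [zero_add] at h1
  have h2 := h1.rpow_const (p := -b) (Or.inl one_ne_zero)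
  rw [Real.one_rpow] at h2
  refine h2.congr' ?_
  filter_upwards [hm.eventually_ge_atTop 1] with n hn
  have : (0:ℝ) < m n := by exact_mod_cast hn
  rw [← Real.div_rpow (by positivity) this.le]
  congr 1
  push_cast
  field_simp
  ring

lemma ratio_le (b : ℝ) (hb : 0 < b) (i m : ℕ) (hm : 1 ≤ m) :
    (1 + ((i + m : ℕ) : ℝ)) ^ (-b) / (m : ℝ) ^ (-b) ≤ 1 := by
  have : (0:ℝ) < m := by exact_mod_cast hm
  rw [div_le_one (Real.rpow_pos_of_pos this _)]
  apply Real.rpow_le_rpow_of_nonpos this _ (by linarith)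
  push_cast
  have : (0:ℝ) ≤ i := by positivity
  linarith

theorem stmt13 (α β₁ β₂ : ℝ)
    (hα : 1 < α) (hα2 : α < 2)
    (hβ₁ : 1 / (α - 1) < β₁) (hβ₂l : 1 < β₂) (hβ₂u : β₂ < 1 / (α - 1))
    (w : ℕ → ℕ → ℝ) (hw : ∀ i j, w i j ≠ 0)
    (hA1 : Tendsto (fun p : ℕ × ℕ => w p.1 p.2) (atTop ×ˢ atTop) (nhds 1))
    (winf : ℕ → ℝ)
    (hA2 : ∀ i, Tendsto (fun j => w i j) atTop (nhds (winf i)) ∧ 0 < winf i)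
    (wco : ℕ → ℝ)
    (hA3 : ∀ j, Tendsto (fun i => w i j) atTop (nhds (wco j)) ∧ 0 < wco j)
    (c : ℕ → ℕ → ℝ)
    (hc : ∀ i j, c i j = w i j * (1 + (i : ℝ)) ^ (-β₁) * (1 + (j : ℝ)) ^ (-β₂))
    (ρ : ℕ → ℕ → ℝ)
    (hsum : ∀ n m : ℕ, 1 ≤ n → 1 ≤ m →
      Summable (fun q : ℕ × ℕ => V α (c (q.1 + n) q.2) (c q.1 (q.2 + m))))
    (hρ : ∀ n m : ℕ, 1 ≤ n → 1 ≤ m →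
      ρ n m = ∑' i : ℕ, ∑' j : ℕ, V α (c (i + n) j) (c i (j + m)))
    (m : ℕ → ℕ) (hm : ∀ n, 1 ≤ m n) (C : ℝ) (hC : 0 < C)
    (hratio : Tendsto (fun n : ℕ => (m n : ℝ) ^ (-β₂) / (n : ℝ) ^ (-β₁))
      atTop (nhds C))
    :
    Tendsto (fun n : ℕ => ρ n (m n) / ((n : ℝ) ^ (-β₁) * (m n : ℝ) ^ (-(β₂ * (α - 1)))))
      atTop
      (nhds (C * ∑' i : ℕ, ∑' j : ℕ,
        V α (wco j * C⁻¹ * (1 + (j : ℝ)) ^ (-β₂)) (winf i * (1 + (i : ℝ)) ^ (-β₁)))) := by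
  have ha1 : 0 < α - 1 := by linarith
  have hb1 : 1 < β₁ * (α - 1) := by rwa [div_lt_iff₀ ha1] at hβ₁
  have hβ₁0 : 0 < β₁ := lt_trans (by positivity) hβ₁
  have hβ₂0 : 0 < β₂ := by linarith
  have hmR : ∀ n, (0:ℝ) < m n := fun n => by exact_mod_cast hm n
  set R : ℕ → ℝ := fun n => (m n : ℝ) ^ (-β₂) / (n : ℝ) ^ (-β₁) with hR
  have hMpos : ∀ n, 0 < (m n : ℝ) ^ (-β₂) := fun n => Real.rpow_pos_of_pos (hmR n) _
  have hNpos : ∀ n : ℕ, 1 ≤ n → 0 < (n : ℝ) ^ (-β₁) := fun n hn =>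
    Real.rpow_pos_of_pos (by exact_mod_cast hn) _
  have hRpos : ∀ n : ℕ, 1 ≤ n → 0 < R n := fun n hn => div_pos (hMpos n) (hNpos n hn)
  -- m tends to infinity
  have hmtop : Tendsto m atTop atTop := by
    have h0 : Tendsto (fun n : ℕ => (n : ℝ) ^ (-β₁)) atTop (nhds 0) :=
      (tendsto_rpow_neg_atTop hβ₁0).comp tendsto_natCast_atTop_atTop
    have h1 : Tendsto (fun n : ℕ => (m n : ℝ) ^ (-β₂)) atTop (nhds 0) := by
      have := hratio.mul h0
      rw [mul_zero] at this
      refine this.congr' ?_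
      filter_upwards [eventually_ge_atTop 1] with n hn
      exact div_mul_cancel₀ _ (hNpos n hn).ne'
    refine tendsto_atTop.mpr fun B => ?_
    have hB : (0:ℝ) < ((B + 1 : ℕ) : ℝ) ^ (-β₂) := Real.rpow_pos_of_pos (by positivity) _
    filter_upwards [h1.eventually (gt_mem_nhds hB)] with n hn
    by_contra hlt
    have h2 : (m n : ℝ) ≤ ((B + 1 : ℕ) : ℝ) := by
      have : m n ≤ B + 1 := by omega
      exact_mod_cast this
    have := Real.rpow_le_rpow_of_nonpos (hmR n) h2 (show -β₂ ≤ 0 by linarith)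
    linarith
  obtain ⟨K, hK, hwK⟩ := w_bdd w hA1 winf wco (fun i => (hA2 i).1) (fun j => (hA3 j).1)
  set X : ℕ → ℕ × ℕ → ℝ := fun n q => w (q.1 + n) q.2 *
    ((1 + ((q.1 + n : ℕ) : ℝ)) ^ (-β₁) / (n : ℝ) ^ (-β₁)) * (R n)⁻¹ * (1 + (q.2 : ℝ)) ^ (-β₂) with hX
  set Y : ℕ → ℕ × ℕ → ℝ := fun n q => w q.1 (q.2 + m n) *
    ((1 + ((q.2 + m n : ℕ) : ℝ)) ^ (-β₂) / (m n : ℝ) ^ (-β₂)) * (1 + (q.1 : ℝ)) ^ (-β₁) with hY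
  set bound : ℕ × ℕ → ℝ := fun q =>
    (K ^ (α - 1) * (1 + (q.1 : ℝ)) ^ (-(β₁ * (α - 1)))) * (K * (2 / C) * (1 + (q.2 : ℝ)) ^ (-β₂))
    with hbound
  have hbs : Summable bound :=
    ((summ_pow _ hb1).mul_left (K ^ (α - 1))).mul_of_nonneg
      ((summ_pow _ hβ₂l).mul_left (K * (2 / C)))
      (fun i => by simp only [Pi.zero_apply]; positivity)
      (fun i => by simp only [Pi.zero_apply]; positivity)
  have hlim : ∀ q : ℕ × ℕ, Tendsto (fun n => V α (X n q) (Y n q)) atTop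
      (nhds (V α (wco q.2 * C⁻¹ * (1 + (q.2 : ℝ)) ^ (-β₂))
        (winf q.1 * (1 + (q.1 : ℝ)) ^ (-β₁)))) := by
    intro q
    apply V_tendsto
    · have := (hA2 q.1).2
      positivity
    · have h1 : Tendsto (fun n => w (q.1 + n) q.2) atTop (nhds (wco q.2)) :=
        (hA3 q.2).1.comp (tendsto_add_atTop_nat q.1 |>.congr fun n => add_comm _ _)
      have h2 := ratio_tendsto β₁ q.1 (fun n => n) tendsto_id
      have := ((h1.mul h2).mul (hratio.inv₀ hC.ne')).mul_const ((1 + (q.2 : ℝ)) ^ (-β₂))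
      rwa [mul_one] at this
    · have h1 : Tendsto (fun n => w q.1 (q.2 + m n)) atTop (nhds (winf q.1)) :=
        (hA2 q.1).1.comp (tendsto_atTop_mono (fun n => Nat.le_add_left (m n) q.2) hmtop)
      have h2 := ratio_tendsto β₂ q.2 m hmtop
      have := (h1.mul h2).mul_const ((1 + (q.1 : ℝ)) ^ (-β₁))
      rwa [mul_one] at this
  have hbd : ∀ᶠ n in atTop, ∀ q : ℕ × ℕ, ‖V α (X n q) (Y n q)‖ ≤ bound q := by
    have hCC : C / 2 < C := by linarith
    filter_upwards [eventually_ge_atTop 1, hratio.eventually (lt_mem_nhds hCC)] with n hn hRn q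
    have hRi : (R n)⁻¹ ≤ 2 / C := by
      rw [← inv_div C 2]
      exact inv_anti₀ (by positivity) hRn.le
    have hRp := hRpos n hn
    have hNp := hNpos n hn
    have hMp := hMpos n
    have e1 : |X n q| ≤ K * 1 * (2 / C) * (1 + (q.2 : ℝ)) ^ (-β₂) := by
      simp only [hX]
      rw [abs_mul, abs_mul, abs_mul, abs_of_pos (inv_pos.mpr hRp),
        abs_of_nonneg (by positivity : (0:ℝ) ≤ (1 + (q.2 : ℝ)) ^ (-β₂)),
        abs_of_nonneg (by positivity : (0:ℝ) ≤ (1 + ((q.1 + n : ℕ) : ℝ)) ^ (-β₁) / (n : ℝ) ^ (-β₁))]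
      have := ratio_le β₁ hβ₁0 q.1 n hn
      have := hwK (q.1 + n) q.2
      gcongr
    have e2 : |Y n q| ≤ K * 1 * (1 + (q.1 : ℝ)) ^ (-β₁) := by
      simp only [hY]
      rw [abs_mul, abs_mul,
        abs_of_nonneg (by positivity : (0:ℝ) ≤ (1 + (q.1 : ℝ)) ^ (-β₁)),
        abs_of_nonneg (by positivity :
          (0:ℝ) ≤ (1 + ((q.2 + m n : ℕ) : ℝ)) ^ (-β₂) / (m n : ℝ) ^ (-β₂))]
      have := ratio_le β₂ hβ₂0 q.2 (m n) (hm n)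
      have := hwK q.1 (q.2 + m n)
      gcongr
    rw [Real.norm_eq_abs]
    refine (V_bound α _ _ _ _ hα hα2 e1 e2).trans (le_of_eq ?_)
    simp only [hbound]
    rw [mul_one, Real.mul_rpow hK.le (by positivity), ← Real.rpow_mul (by positivity), neg_mul]
    ring
  have hmain := tendsto_tsum_of_dominated_convergence hbs hlim hbd
  have hLs : Summable (fun q : ℕ × ℕ => V α (wco q.2 * C⁻¹ * (1 + (q.2 : ℝ)) ^ (-β₂))
        (winf q.1 * (1 + (q.1 : ℝ)) ^ (-β₁))) := by
    refine Summable.of_norm_bounded hbs fun q => ?_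
    exact le_of_tendsto (hlim q).norm (hbd.mono fun n h => h q)
  rw [hLs.tsum_prod] at hmain
  refine (hratio.mul hmain).congr' ?_
  filter_upwards [eventually_ge_atTop 1] with n hn
  have hs := hsum n (m n) hn (hm n)
  have hMp := hMpos n
  have hNp := hNpos n hn
  rw [hρ n (m n) hn (hm n), ← hs.tsum_prod (f := fun q : ℕ × ℕ => V α (c (q.1 + n) q.2) (c q.1 (q.2 + m n)))]
  have hterm : ∀ q : ℕ × ℕ, V α (c (q.1 + n) q.2) (c q.1 (q.2 + m n)) =
      ((m n : ℝ) ^ (-β₂)) ^ α * V α (X n q) (Y n q) := by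
    intro q
    rw [← V_hom _ _ _ _ hMp]
    congr 1
    · rw [hc]; simp only [hX, hR]
      field_simp
    · rw [hc]; simp only [hY]
      field_simp
  simp_rw [hterm]
  rw [tsum_mul_left]
  have e1 : (m n : ℝ) ^ (-(β₂ * (α - 1))) = ((m n : ℝ) ^ (-β₂)) ^ (α - 1) := by
    rw [← Real.rpow_mul (hmR n).le, neg_mul]
  have e2 : ((m n : ℝ) ^ (-β₂)) ^ α = (m n : ℝ) ^ (-β₂) * ((m n : ℝ) ^ (-β₂)) ^ (α - 1) := by
    rw [← Real.rpow_one_add' hMp.le (by linarith)]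
    congr 1; ring
  rw [e1, e2]
  have hq := Real.rpow_pos_of_pos hMp (α - 1)
  simp only [hR]
  generalize ((m n : ℝ) ^ (-β₂)) ^ (α - 1) = A at hq
  field_simp
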